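/- Let f be a ternary cubic form over ℂ with Δ(f) ≠ 0. Then the stabilizer of f in SL₃(ℂ), i.e., the set of γ ∈ SL₃(ℂ) with γ·f = f, has exactly 27 elements. -/

import Mathlib

open MvPolynomial

/-- The action of a 3×3 matrix on ternary forms: `(γ·f)(x,y,z) = f((x,y,z)·γ)`. -/
noncomputable def actGL {R : Type*} [CommRing R] (γ : Matrix (Fin 3) (Fin 3) R)
    (f : MvPolynomial (Fin 3) R) : MvPolynomial (Fin 3) R :=
  bind₁ (fun j => ∑ i : Fin 3, C (γ i j) * X i) f

/-- The Hessian of a ternary form: the determinant of the matrix of second partials. -/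
noncomputable def hess {R : Type*} [CommRing R] (f : MvPolynomial (Fin 3) R) :
    MvPolynomial (Fin 3) R :=
  Matrix.det (Matrix.of fun i j => pderiv i (pderiv j f))

/-- The exponent vectors of the ten monomials of a ternary cubic form. -/
def expo : Fin 10 → Fin 3 → ℕ :=
  ![![3,0,0], ![0,3,0], ![0,0,3], ![2,1,0], ![2,0,1],
    ![1,2,0], ![0,2,1], ![1,0,2], ![0,1,2], ![1,1,1]]

/-- The ternary cubic form with coefficient vector `c : Fin 10 → R`. -/
noncomputable def cubic {R : Type*} [CommRing R] (c : Fin 10 → R) : MvPolynomial (Fin 3) R :=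
  ∑ k : Fin 10, C (c k) * ∏ i : Fin 3, X i ^ expo k i

/-- The coefficient vector of the Weierstrass cubic `x³ + A·x·z² + B·z³ − y²·z`. -/
noncomputable def wcoeffs {R : Type*} [CommRing R] (A B : R) : Fin 10 → R :=
  ![1, 0, B, 0, 0, 0, -1, A, 0, 0]

/-- The generic ternary cubic form, whose coefficients are the 10 indeterminates. -/
noncomputable def genCubic (R : Type*) [CommRing R] :
    MvPolynomial (Fin 3) (MvPolynomial (Fin 10) R) :=
  cubic (fun k => X k)

/-- `P` and `Q` are the invariants `I` and `J`: they are homogeneous of degrees 4 and 6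
in the ten coefficients, they satisfy the identity
`H(H(f)) = 12288·I(f)²·f + 512·J(f)·H(f)` (stated for the generic ternary cubic form,
hence for every ternary cubic form over every commutative `R`-algebra), and they are
normalized so that `x³ + A·x·z² + B·z³ − y²·z` has `I = −3A` and `J = −27B`. -/
def IsInvariantPair (R : Type*) [CommRing R] (P Q : MvPolynomial (Fin 10) R) : Prop :=
  P.IsHomogeneous 4 ∧ Q.IsHomogeneous 6 ∧
  hess (hess (genCubic R)) =
    12288 * C P ^ 2 * genCubic R + 512 * C Q * hess (genCubic R) ∧
  ∀ A B : R, aeval (wcoeffs A B) P = -3 * A ∧ aeval (wcoeffs A B) Q = -27 * B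

/-- The explicit coefficients of the Hessian. -/
def hessC {R : Type*} [CommRing R] (c : Fin 10 → R) : Fin 10 → R :=
  ![0 + 24 * c 0 * c 5 * c 7 - 6 * c 0 * c 9 * c 9 - 8 * c 3 * c 3 * c 7 + 8 * c 3 * c 4 * c 9 - 8 * c 4 * c 4 * c 5,
    0 + 24 * c 1 * c 3 * c 8 - 6 * c 1 * c 9 * c 9 - 8 * c 3 * c 6 * c 6 - 8 * c 5 * c 5 * c 8 + 8 * c 5 * c 6 * c 9,
    0 + 24 * c 2 * c 4 * c 6 - 6 * c 2 * c 9 * c 9 - 8 * c 4 * c 8 * c 8 - 8 * c 6 * c 7 * c 7 + 8 * c 7 * c 8 * c 9,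
    0 + 72 * c 0 * c 1 * c 7 + 24 * c 0 * c 5 * c 8 - 24 * c 0 * c 6 * c 9 - 24 * c 1 * c 4 * c 4 - 8 * c 3 * c 3 * c 8 + 16 * c 3 * c 4 * c 6 - 8 * c 3 * c 5 * c 7 + 2 * c 3 * c 9 * c 9,
    0 + 72 * c 0 * c 2 * c 5 + 24 * c 0 * c 6 * c 7 - 24 * c 0 * c 8 * c 9 - 24 * c 2 * c 3 * c 3 + 16 * c 3 * c 4 * c 8 - 8 * c 4 * c 4 * c 6 - 8 * c 4 * c 5 * c 7 + 2 * c 4 * c 9 * c 9,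
    0 + 72 * c 0 * c 1 * c 8 - 24 * c 0 * c 6 * c 6 + 24 * c 1 * c 3 * c 7 - 24 * c 1 * c 4 * c 9 - 8 * c 3 * c 5 * c 8 + 16 * c 4 * c 5 * c 6 - 8 * c 5 * c 5 * c 7 + 2 * c 5 * c 9 * c 9,
    0 + 72 * c 1 * c 2 * c 3 + 24 * c 1 * c 4 * c 8 - 24 * c 1 * c 7 * c 9 - 24 * c 2 * c 5 * c 5 - 8 * c 3 * c 6 * c 8 - 8 * c 4 * c 6 * c 6 + 16 * c 5 * c 6 * c 7 + 2 * c 6 * c 9 * c 9,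
    0 + 72 * c 0 * c 2 * c 6 - 24 * c 0 * c 8 * c 8 - 24 * c 2 * c 3 * c 9 + 24 * c 2 * c 4 * c 5 + 16 * c 3 * c 7 * c 8 - 8 * c 4 * c 6 * c 7 - 8 * c 5 * c 7 * c 7 + 2 * c 7 * c 9 * c 9,
    0 + 72 * c 1 * c 2 * c 4 - 24 * c 1 * c 7 * c 7 + 24 * c 2 * c 3 * c 6 - 24 * c 2 * c 5 * c 9 - 8 * c 3 * c 8 * c 8 - 8 * c 4 * c 6 * c 8 + 16 * c 5 * c 7 * c 8 + 2 * c 8 * c 9 * c 9,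
    0 + 216 * c 0 * c 1 * c 2 - 24 * c 0 * c 6 * c 8 - 24 * c 1 * c 4 * c 7 - 24 * c 2 * c 3 * c 5 + 24 * c 3 * c 6 * c 7 - 8 * c 3 * c 8 * c 9 + 24 * c 4 * c 5 * c 8 - 8 * c 4 * c 6 * c 9 - 8 * c 5 * c 7 * c 9 + 2 * c 9 * c 9 * c 9]

/-- The polarisation `∑ⱼ ∂ⱼF(u) vⱼ`. -/
def polG {R : Type*} [CommRing R] (c : Fin 10 → R) (u v : Fin 3 → R) : R :=
  (3 * c 0 * u 0 ^ 2 + 2 * c 3 * u 0 * u 1 + 2 * c 4 * u 0 * u 2 + c 5 * u 1 ^ 2 + c 7 * u 2 ^ 2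
    + c 9 * u 1 * u 2) * v 0
  + (3 * c 1 * u 1 ^ 2 + c 3 * u 0 ^ 2 + 2 * c 5 * u 0 * u 1 + 2 * c 6 * u 1 * u 2 + c 8 * u 2 ^ 2
    + c 9 * u 0 * u 2) * v 1
  + (3 * c 2 * u 2 ^ 2 + c 4 * u 0 ^ 2 + c 6 * u 1 ^ 2 + 2 * c 7 * u 0 * u 2 + 2 * c 8 * u 1 * u 2
    + c 9 * u 0 * u 1) * v 2

/-- The value of the cubic form. -/
def polF {R : Type*} [CommRing R] (c : Fin 10 → R) (u : Fin 3 → R) : R :=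
  c 0 * u 0 ^ 3 + c 1 * u 1 ^ 3 + c 2 * u 2 ^ 3 + c 3 * u 0 ^ 2 * u 1 + c 4 * u 0 ^ 2 * u 2
  + c 5 * u 0 * u 1 ^ 2 + c 6 * u 1 ^ 2 * u 2 + c 7 * u 0 * u 2 ^ 2 + c 8 * u 1 * u 2 ^ 2
  + c 9 * u 0 * u 1 * u 2

/-- The full polarisation of the cubic form. -/
def polT {R : Type*} [CommRing R] (c : Fin 10 → R) (u v w : Fin 3 → R) : R :=
  6 * c 0 * u 0 * v 0 * w 0 + 6 * c 1 * u 1 * v 1 * w 1 + 6 * c 2 * u 2 * v 2 * w 2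
  + 2 * c 3 * (u 0 * v 0 * w 1 + u 0 * v 1 * w 0 + u 1 * v 0 * w 0)
  + 2 * c 4 * (u 0 * v 0 * w 2 + u 0 * v 2 * w 0 + u 2 * v 0 * w 0)
  + 2 * c 5 * (u 1 * v 1 * w 0 + u 1 * v 0 * w 1 + u 0 * v 1 * w 1)
  + 2 * c 6 * (u 1 * v 1 * w 2 + u 1 * v 2 * w 1 + u 2 * v 1 * w 1)
  + 2 * c 7 * (u 2 * v 2 * w 0 + u 2 * v 0 * w 2 + u 0 * v 2 * w 2)
  + 2 * c 8 * (u 2 * v 2 * w 1 + u 2 * v 1 * w 2 + u 1 * v 2 * w 2)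
  + c 9 * (u 0 * v 1 * w 2 + u 0 * v 2 * w 1 + u 1 * v 0 * w 2 + u 1 * v 2 * w 0
    + u 2 * v 0 * w 1 + u 2 * v 1 * w 0)

/-- The action on coefficient vectors. -/
def actC {R : Type*} [CommRing R] (γ : Matrix (Fin 3) (Fin 3) R) (c : Fin 10 → R) : Fin 10 → R :=
  ![polF c (γ 0), polF c (γ 1), polF c (γ 2), polG c (γ 0) (γ 1), polG c (γ 0) (γ 2),
    polG c (γ 1) (γ 0), polG c (γ 1) (γ 2), polG c (γ 2) (γ 0), polG c (γ 2) (γ 1),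
    polT c (γ 0) (γ 1) (γ 2)]

theorem cubic_eq {R : Type*} [CommRing R] (c : Fin 10 → R) :
    cubic c = C (c 0) * X 0 ^ 3 + C (c 1) * X 1 ^ 3 + C (c 2) * X 2 ^ 3 + C (c 3) * (X 0 ^ 2 * X 1)
      + C (c 4) * (X 0 ^ 2 * X 2) + C (c 5) * (X 0 * X 1 ^ 2) + C (c 6) * (X 1 ^ 2 * X 2)
      + C (c 7) * (X 0 * X 2 ^ 2) + C (c 8) * (X 1 * X 2 ^ 2) + C (c 9) * (X 0 * X 1 * X 2) := by
  simp only [cubic, expo, Fin.sum_univ_succ, Fin.prod_univ_three]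
  simp [Fin.succ]
  ring

theorem eval_cubic {R : Type*} [CommRing R] (c : Fin 10 → R) (u : Fin 3 → R) :
    eval u (cubic c) = polF c u := by
  rw [cubic_eq]; simp [polF]; ring

set_option maxRecDepth 20000 in
set_option maxHeartbeats 1000000 in
theorem actGL_cubic {R : Type*} [CommRing R] (γ : Matrix (Fin 3) (Fin 3) R) (c : Fin 10 → R) :
    actGL γ (cubic c) = cubic (actC γ c) := by
  have h2 : (C 2 : MvPolynomial (Fin 3) R) = 2 := map_ofNat C 2
  have h3 : (C 3 : MvPolynomial (Fin 3) R) = 3 := map_ofNat C 3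
  have h6 : (C 6 : MvPolynomial (Fin 3) R) = 6 := map_ofNat C 6
  rw [cubic_eq, cubic_eq]
  simp only [actGL, map_add, map_mul, map_pow, bind₁_X_right, bind₁_C_right, Fin.sum_univ_three]
  simp [actC, polF, polG, polT, h2, h3, h6]
  ring

set_option maxRecDepth 20000 in
set_option maxHeartbeats 4000000 in
theorem hess_cubic {R : Type*} [CommRing R] (c : Fin 10 → R) :
    hess (cubic c) = cubic (hessC c) := by
  have hn : ∀ n : ℕ, [n.AtLeastTwo] → (C (OfNat.ofNat n) : MvPolynomial (Fin 3) R) = OfNat.ofNat n :=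
    fun n _ => map_ofNat C n
  have p2 : ∀ i, pderiv i (2 : MvPolynomial (Fin 3) R) = 0 := fun i => by rw [← hn 2, pderiv_C]
  have p3 : ∀ i, pderiv i (3 : MvPolynomial (Fin 3) R) = 0 := fun i => by rw [← hn 3, pderiv_C]
  rw [cubic_eq, cubic_eq, hess, Matrix.det_fin_three]
  simp [pderiv_X, Pi.single_apply, Derivation.leibniz, Derivation.leibniz_pow, hessC, hn, p2, p3]
  ring

theorem cubic_inj {R : Type*} [CommRing R] {c d : Fin 10 → R} (h : cubic c = cubic d) : c = d := by
  have key : ∀ (c : Fin 10 → R) (k : Fin 10),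
      coeff (Finsupp.equivFunOnFinite.symm (expo k)) (cubic c) = c k := by
    intro c k
    have hm : ∀ j : Fin 10, (C (c j) * ∏ i : Fin 3, X i ^ expo j i : MvPolynomial (Fin 3) R)
        = monomial (Finsupp.equivFunOnFinite.symm (expo j)) (c j) := by
      intro j
      rw [monomial_eq, Finsupp.prod_fintype _ _ (by simp)]
      simp
    have hinj : Function.Injective expo := by decide
    simp only [cubic, hm, coeff_sum, coeff_monomial]
    simp [hinj.eq_iff]
  funext k
  rw [← key c k, h, key]

theorem actGL_mul {R : Type*} [CommRing R] (γ δ : Matrix (Fin 3) (Fin 3) R)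
    (f : MvPolynomial (Fin 3) R) : actGL γ (actGL δ f) = actGL (γ * δ) f := by
  simp only [actGL, bind₁_bind₁]
  congr 2
  funext j
  simp [Matrix.mul_apply, Fin.sum_univ_three]
  ring

theorem actGL_one {R : Type*} [CommRing R] (f : MvPolynomial (Fin 3) R) : actGL 1 f = f := by
  have : (fun j => ∑ i : Fin 3, C ((1 : Matrix (Fin 3) (Fin 3) R) i j) * X i)
      = (X : Fin 3 → MvPolynomial (Fin 3) R) := by
    funext j
    simp [Matrix.one_apply]
  rw [actGL, this, bind₁_X_left]; rfl

theorem actC_mul {R : Type*} [CommRing R] (γ δ : Matrix (Fin 3) (Fin 3) R) (c : Fin 10 → R) :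
    actC γ (actC δ c) = actC (γ * δ) c := by
  apply cubic_inj
  rw [← actGL_cubic, ← actGL_cubic, ← actGL_cubic, actGL_mul]

theorem actC_one {R : Type*} [CommRing R] (c : Fin 10 → R) : actC 1 c = c := by
  apply cubic_inj
  rw [← actGL_cubic, actGL_one]

theorem pderiv_actGL {R : Type*} [CommRing R] (γ : Matrix (Fin 3) (Fin 3) R)
    (f : MvPolynomial (Fin 3) R) (i : Fin 3) :
    pderiv i (actGL γ f) = ∑ j, C (γ i j) * actGL γ (pderiv j f) := by
  induction f using MvPolynomial.induction_on with
  | C a => simp [actGL]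
  | add p q hp hq =>
    simp only [actGL, map_add] at *
    rw [hp, hq, ← Finset.sum_add_distrib]
    simp [mul_add]
  | mul_X p n hp =>
    simp only [actGL, map_mul, bind₁_X_right, Derivation.leibniz, map_add, smul_eq_mul] at *
    rw [hp]
    fin_cases n <;> fin_cases i <;>
    simp [Fin.sum_univ_three, pderiv_X, Pi.single_apply] <;> ring

theorem hess_actGL {R : Type*} [CommRing R] (γ : Matrix (Fin 3) (Fin 3) R)
    (f : MvPolynomial (Fin 3) R) :
    hess (actGL γ f) = C (γ.det) ^ 2 * actGL γ (hess f) := by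
  have h1 : (Matrix.of fun i j => pderiv i (pderiv j (actGL γ f)))
      = (γ.map C) * ((Matrix.of fun i j => pderiv i (pderiv j f)).map (bind₁ (fun j => ∑ i : Fin 3, C (γ i j) * X i)))
        * (γ.map C).transpose := by
    ext1 i j
    have e1 : pderiv i (pderiv j (actGL γ f))
        = ∑ k, C (γ j k) * ∑ l, C (γ i l) * actGL γ (pderiv l (pderiv k f)) := by
      rw [pderiv_actGL, map_sum]
      refine Finset.sum_congr rfl fun k _ => ?_
      rw [pderiv_C_mul, pderiv_actGL]
    rw [Matrix.of_apply, e1]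
    simp only [Matrix.mul_apply, Matrix.map_apply, Matrix.transpose_apply, Matrix.of_apply]
    change _ = ∑ x, (∑ y, C (γ i y) * actGL γ (pderiv y (pderiv x f))) * C (γ j x)
    exact Finset.sum_congr rfl fun k _ => mul_comm _ _
  rw [hess, h1, Matrix.det_mul, Matrix.det_mul, Matrix.det_transpose, hess, actGL]
  have h2 : (γ.map C).det = (C γ.det : MvPolynomial (Fin 3) R) := by
    rw [← RingHom.mapMatrix_apply, ← RingHom.map_det]
  rw [h2]
  have h3 := (AlgHom.map_det (bind₁ (fun j => ∑ i : Fin 3, C (γ i j) * X i)) (Matrix.of fun i j => pderiv i (pderiv j f)))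
  rw [h3, AlgHom.mapMatrix_apply]
  ring

theorem cubic_smul {R : Type*} [CommRing R] (t : R) (c : Fin 10 → R) :
    cubic (t • c) = C t * cubic c := by
  rw [cubic_eq, cubic_eq]; simp; ring

theorem hessC_actC {R : Type*} [CommRing R] (γ : Matrix (Fin 3) (Fin 3) R) (c : Fin 10 → R) :
    hessC (actC γ c) = (γ.det ^ 2) • actC γ (hessC c) := by
  apply cubic_inj
  rw [cubic_smul, ← hess_cubic, ← actGL_cubic, ← actGL_cubic, hess_actGL, hess_cubic, C_pow]

theorem hessC_smul {R : Type*} [CommRing R] (t : R) (c : Fin 10 → R) :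
    hessC (t • c) = t ^ 3 • hessC c := by
  funext k
  fin_cases k <;> simp [hessC] <;> ring

theorem actC_add {R : Type*} [CommRing R] (γ : Matrix (Fin 3) (Fin 3) R) (c d : Fin 10 → R) :
    actC γ (c + d) = actC γ c + actC γ d := by
  funext k
  fin_cases k <;> simp [actC, polF, polG, polT] <;> ring

theorem actC_smul {R : Type*} [CommRing R] (γ : Matrix (Fin 3) (Fin 3) R) (t : R) (c : Fin 10 → R) :
    actC γ (t • c) = t • actC γ c := by
  funext k
  fin_cases k <;> simp [actC, polF, polG, polT] <;> ring

theorem actC_map {R S : Type*} [CommRing R] [CommRing S] (φ : R →+* S)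
    (γ : Matrix (Fin 3) (Fin 3) R) (c : Fin 10 → R) :
    (fun k => φ (actC γ c k)) = actC (γ.map φ) (fun k => φ (c k)) := by
  have h2 : φ 2 = 2 := map_ofNat φ 2
  have h3 : φ 3 = 3 := map_ofNat φ 3
  have h6 : φ 6 = 6 := map_ofNat φ 6
  funext k
  fin_cases k <;> simp [actC, polF, polG, polT, h2, h3, h6]

theorem hessC_map {R S : Type*} [CommRing R] [CommRing S] (φ : R →+* S) (c : Fin 10 → R) :
    (fun k => φ (hessC c k)) = hessC (fun k => φ (c k)) := by
  have hn : ∀ n : ℕ, [n.AtLeastTwo] → φ (OfNat.ofNat n) = OfNat.ofNat n :=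
    fun n _ => map_ofNat φ n
  funext k
  fin_cases k <;> simp [hessC, hn]

theorem inv_ident (P Q : MvPolynomial (Fin 10) ℚ) (hPQ : IsInvariantPair ℚ P Q)
    {K : Type*} [CommRing K] [Algebra ℚ K] (c : Fin 10 → K) :
    hessC (hessC c) = (12288 * (aeval c P) ^ 2) • c + (512 * aeval c Q) • hessC c := by
  obtain ⟨-, -, h, -⟩ := hPQ
  have h1 : hessC (hessC (fun k => (X k : MvPolynomial (Fin 10) ℚ)))
      = (12288 * P ^ 2) • (fun k => X k) + (512 * Q) • hessC (fun k => X k) := by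
    apply cubic_inj
    rw [← hess_cubic, ← hess_cubic]
    have hadd : ∀ c d : Fin 10 → MvPolynomial (Fin 10) ℚ, cubic (c + d) = cubic c + cubic d := by
      intro c d
      simp only [cubic_eq, Pi.add_apply, map_add]; ring
    rw [hadd, cubic_smul, cubic_smul, ← hess_cubic]
    have hn : ∀ n : ℕ, [n.AtLeastTwo] → (C (OfNat.ofNat n) :
      MvPolynomial (Fin 3) (MvPolynomial (Fin 10) ℚ)) = OfNat.ofNat n := fun n _ => map_ofNat C n
    simp only [map_mul, map_pow, hn]
    exact h
  have h2 := congrArg (fun g : Fin 10 → MvPolynomial (Fin 10) ℚ =>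
    (fun k => (aeval c : _ →ₐ[ℚ] K).toRingHom (g k))) h1
  simp only [Pi.add_apply, Pi.smul_apply, smul_eq_mul, map_add, map_mul] at h2
  rw [hessC_map, hessC_map] at h2
  have hn : ∀ n : ℕ, [n.AtLeastTwo] → ((aeval c : _ →ₐ[ℚ] K).toRingHom (OfNat.ofNat n)) = OfNat.ofNat n :=
    fun n _ => map_ofNat (aeval c : _ →ₐ[ℚ] K).toRingHom n
  have h3 := hessC_map (aeval c : _ →ₐ[ℚ] K).toRingHom (fun k => (X k : MvPolynomial (Fin 10) ℚ))
  have h4 : (fun k => (aeval c : _ →ₐ[ℚ] K).toRingHom (X k : MvPolynomial (Fin 10) ℚ)) = c := by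
    funext k; simp
  rw [h4] at h3 h2
  rw [h2]
  funext k
  have h5 := congrFun h3 k
  have h6 := congrFun h4 k
  simp only [Pi.add_apply, Pi.smul_apply, smul_eq_mul, h5, h6, hn, map_pow]
  rfl

theorem inv_pre (P Q : MvPolynomial (Fin 10) ℚ) (hPQ : IsInvariantPair ℚ P Q)
    {K : Type*} [CommRing K] [IsDomain K] [Algebra ℚ K] (c : Fin 10 → K)
    (γ : Matrix (Fin 3) (Fin 3) K)
    (hm : actC γ c 0 * hessC (actC γ c) 5 - actC γ c 5 * hessC (actC γ c) 0 ≠ 0) :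
    (aeval (actC γ c) P) ^ 2 = (γ.det ^ 4 * aeval c P) ^ 2 ∧
      aeval (actC γ c) Q = γ.det ^ 6 * aeval c Q := by
  have h1 := inv_ident P Q hPQ (actC γ c)
  have h2 : hessC (hessC (actC γ c)) = (12288 * (γ.det ^ 4 * aeval c P) ^ 2) • actC γ c
      + (512 * (γ.det ^ 6 * aeval c Q)) • hessC (actC γ c) := by
    rw [hessC_actC, hessC_smul, hessC_actC, inv_ident P Q hPQ c, actC_add, actC_smul, actC_smul]
    funext k
    simp only [Pi.add_apply, Pi.smul_apply, smul_eq_mul]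
    ring
  rw [h2] at h1
  have : CharZero K := algebraRat.charZero K
  set a := actC γ c
  set b := hessC a
  have e0 := congrFun h1 0
  have e5 := congrFun h1 5
  simp only [Pi.add_apply, Pi.smul_apply, smul_eq_mul] at e0 e5
  constructor
  · have : 12288 * ((aeval a P) ^ 2 - (γ.det ^ 4 * aeval c P) ^ 2) * (a 0 * b 5 - a 5 * b 0) = 0 := by
      linear_combination b 0 * e5 - b 5 * e0
    have h := (mul_eq_zero.mp this).resolve_right hm
    have h' := (mul_eq_zero.mp h).resolve_left (by norm_num)
    exact sub_eq_zero.mp h'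
  · have : 512 * ((aeval a Q) - (γ.det ^ 6 * aeval c Q)) * (a 0 * b 5 - a 5 * b 0) = 0 := by
      linear_combination a 5 * e0 - a 0 * e5
    have h := (mul_eq_zero.mp this).resolve_right hm
    have h' := (mul_eq_zero.mp h).resolve_left (by norm_num)
    exact sub_eq_zero.mp h'

theorem aeval_map' {K L : Type*} [CommRing K] [CommRing L] [Algebra ℚ K] [Algebra ℚ L]
    (φ : K →ₐ[ℚ] L) (c : Fin 10 → K) (P : MvPolynomial (Fin 10) ℚ) :
    φ (aeval c P) = aeval (fun k => φ (c k)) P := by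
  rw [← AlgHom.comp_apply, comp_aeval]

theorem inv_act (P Q : MvPolynomial (Fin 10) ℚ) (hPQ : IsInvariantPair ℚ P Q)
    {K : Type} [CommRing K] [Algebra ℚ K] (c : Fin 10 → K) (γ : Matrix (Fin 3) (Fin 3) K) :
    aeval (actC γ c) P = γ.det ^ 4 * aeval c P ∧
      aeval (actC γ c) Q = γ.det ^ 6 * aeval c Q := by
  let c0 : Fin 10 → MvPolynomial (Fin 10 ⊕ Fin 3 × Fin 3) ℚ := fun k => X (Sum.inl k)
  let γ0 : Matrix (Fin 3) (Fin 3) (MvPolynomial (Fin 10 ⊕ Fin 3 × Fin 3) ℚ) :=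
    fun i j => X (Sum.inr (i, j))
  -- specialisation
  have spec : ∀ {L : Type} [CommRing L] [Algebra ℚ L] (d : Fin 10 → L)
      (δ : Matrix (Fin 3) (Fin 3) L), ∃ φ : MvPolynomial (Fin 10 ⊕ Fin 3 × Fin 3) ℚ →ₐ[ℚ] L,
        (fun k => φ (c0 k)) = d ∧ γ0.map φ = δ ∧ (fun k => φ (actC γ0 c0 k)) = actC δ d
        ∧ φ γ0.det = δ.det := by
    intro L _ _ d δ
    let φ : MvPolynomial (Fin 10 ⊕ Fin 3 × Fin 3) ℚ →ₐ[ℚ] L :=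
      aeval (Sum.elim d (fun p => δ p.1 p.2))
    have h1 : (fun k => φ (c0 k)) = d := by funext k; simp [φ, c0]
    have h2 : γ0.map φ = δ := by ext i j; exact (aeval_X _ _)
    refine ⟨φ, h1, h2, ?_, ?_⟩
    · have := actC_map φ.toRingHom γ0 c0
      rw [← h1, ← h2]; exact this
    · rw [AlgHom.map_det, AlgHom.mapMatrix_apply, h2]
  have hm : actC γ0 c0 0 * hessC (actC γ0 c0) 5 - actC γ0 c0 5 * hessC (actC γ0 c0) 0 ≠ 0 := by
    intro h
    obtain ⟨φ, h1, h2, h3, -⟩ := spec (L := ℚ) ![1, 0, 0, 0, 0, 0, -1, 0, 0, 0] 1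
    have h4 := congrArg φ h
    have h5 := hessC_map φ.toRingHom (actC γ0 c0)
    have h5' : ∀ k, φ (hessC (actC γ0 c0) k) = hessC (fun k => φ (actC γ0 c0 k)) k :=
      fun k => congrFun h5 k
    have h3' : ∀ k, φ (actC γ0 c0 k) = actC 1 ![1, 0, 0, 0, 0, 0, -1, 0, 0, 0] k :=
      fun k => congrFun h3 k
    rw [map_sub, map_mul, map_mul, h5', h5', h3, h3', h3', actC_one] at h4
    simp [hessC] at h4
  have pre := inv_pre P Q hPQ c0 γ0 hm
  have hP0 : P ≠ 0 := by
    intro h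
    have := (hPQ.2.2.2 1 0).1
    rw [h] at this
    norm_num at this
  have hP : aeval (actC γ0 c0) P = γ0.det ^ 4 * aeval c0 P := by
    rcases sq_eq_sq_iff_eq_or_eq_neg.mp pre.1 with h | h
    · exact h
    · exfalso
      obtain ⟨φ, h1, h2, h3, h4⟩ := spec (L := MvPolynomial (Fin 10) ℚ) X 1
      have h5 := congrArg φ h
      rw [aeval_map', h3, map_neg, map_mul, map_pow, h4, aeval_map', h1, actC_one] at h5
      simp only [Matrix.det_one, one_pow, one_mul, aeval_X_left, AlgHom.id_apply] at h5
      exact hP0 (self_eq_neg.mp h5)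
  obtain ⟨φ, h1, h2, h3, h4⟩ := spec c γ
  constructor
  · have h5 := congrArg φ hP
    rwa [aeval_map', h3, map_mul, map_pow, h4, aeval_map', h1] at h5
  · have h5 := congrArg φ pre.2
    rwa [aeval_map', h3, map_mul, map_pow, h4, aeval_map', h1] at h5

theorem aeval_smul_hom {K : Type*} [CommRing K] [Algebra ℚ K] (P : MvPolynomial (Fin 10) ℚ) (n : ℕ)
    (hP : P.IsHomogeneous n) (t : K) (c : Fin 10 → K) :
    aeval (t • c) P = t ^ n * aeval c P := by
  rw [aeval_def, aeval_def, eval₂_eq', eval₂_eq', Finset.mul_sum]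
  refine Finset.sum_congr rfl fun d hd => ?_
  have hdeg : ∑ i, d i = n := by
    have := hP (mem_support_iff.mp hd)
    rw [← this, Finsupp.weight_apply, Finsupp.sum_fintype _ _ (by simp)]
    simp
  simp only [Pi.smul_apply, smul_eq_mul, mul_pow, Finset.prod_mul_distrib, Finset.prod_pow_eq_pow_sum,
    hdeg]
  ring

/-- `4 I ^ 3 - J ^ 2`. -/
noncomputable def disc (P Q : MvPolynomial (Fin 10) ℚ) (c : Fin 10 → ℂ) : ℂ :=
  4 * (aeval c P : ℂ) ^ 3 - (aeval c Q : ℂ) ^ 2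

theorem disc_act (P Q : MvPolynomial (Fin 10) ℚ) (hPQ : IsInvariantPair ℚ P Q)
    (c : Fin 10 → ℂ) (γ : Matrix (Fin 3) (Fin 3) ℂ) :
    disc P Q (actC γ c) = γ.det ^ 12 * disc P Q c := by
  rw [disc, (inv_act P Q hPQ c γ).1, (inv_act P Q hPQ c γ).2, disc]; ring

theorem degen_pre (P : MvPolynomial (Fin 10) ℚ) (n : ℕ) (hn : P.IsHomogeneous n)
    (hP : ∀ (c : Fin 10 → Polynomial ℂ) (γ : Matrix (Fin 3) (Fin 3) (Polynomial ℂ)),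
      aeval (actC γ c) P = γ.det ^ n * aeval c P)
    (c : Fin 10 → ℂ) (h2 : c 2 = 0) (h7 : c 7 = 0) (h8 : c 8 = 0) :
    aeval c P = aeval ![0, 0, 0, 0, c 4, 0, c 6, 0, 0, c 9] P := by
  let T : Polynomial ℂ := Polynomial.X
  let K : ℂ → Polynomial ℂ := fun a => Polynomial.C a
  let c1 : Fin 10 → Polynomial ℂ := fun k => K (c k)
  let d : Fin 10 → Polynomial ℂ := ![T * c1 0, T * c1 1, 0, T * c1 3, c1 4, T * c1 5, c1 6, 0, 0, c1 9]
  let γ : Matrix (Fin 3) (Fin 3) (Polynomial ℂ) := !![T, 0, 0; 0, T, 0; 0, 0, 1]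
  have e2 : c1 2 = 0 := by simp [c1, K, h2]
  have e7 : c1 7 = 0 := by simp [c1, K, h7]
  have e8 : c1 8 = 0 := by simp [c1, K, h8]
  have hact : actC γ c1 = (T ^ 2) • d := by
    funext k
    fin_cases k <;> simp [actC, polF, polG, polT, γ, d, e2, e7, e8] <;> ring
  have hdet : γ.det = T ^ 2 := by simp [γ, Matrix.det_fin_three]; ring
  have h := hP c1 γ
  rw [hact, hdet, aeval_smul_hom P n hn] at h
  have hT : (T ^ 2) ^ n ≠ 0 := pow_ne_zero _ (pow_ne_zero _ Polynomial.X_ne_zero)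
  have h' := mul_left_cancel₀ hT h
  let φ : Polynomial ℂ →ₐ[ℚ] ℂ := (Polynomial.aeval (0 : ℂ)).restrictScalars ℚ
  have h3 := congrArg φ h'
  rw [aeval_map', aeval_map'] at h3
  have e1 : (fun k => φ (c1 k)) = c := by
    funext k
    simp [φ, c1, K]
  have e2 : (fun k => φ (d k)) = ![0, 0, 0, 0, c 4, 0, c 6, 0, 0, c 9] := by
    funext k
    fin_cases k <;> simp [φ, d, c1, K, T]
  rw [e1, e2] at h3
  exact h3.symm

theorem degen (P Q : MvPolynomial (Fin 10) ℚ) (hPQ : IsInvariantPair ℚ P Q)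
    (c : Fin 10 → ℂ) (h2 : c 2 = 0) (h7 : c 7 = 0) (h8 : c 8 = 0) :
    disc P Q c = disc P Q ![0, 0, 0, 0, c 4, 0, c 6, 0, 0, c 9] := by
  rw [disc, disc, degen_pre P 4 hPQ.1 (fun c γ => (inv_act P Q hPQ c γ).1) c h2 h7 h8,
    degen_pre Q 6 hPQ.2.1 (fun c γ => (inv_act P Q hPQ c γ).2) c h2 h7 h8]

theorem disc_node (P Q : MvPolynomial (Fin 10) ℚ) (hPQ : IsInvariantPair ℚ P Q) :
    disc P Q ![0, 0, 0, 0, 3, 0, -1, 0, 0, 0] = 0 := by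
  have hW : disc P Q ![1, 0, 2, 0, 0, 0, -1, -3, 0, 0] = 0 := by
    have e : (fun k => (Algebra.ofId ℚ ℂ) (wcoeffs (-3 : ℚ) 2 k))
        = ![1, 0, 2, 0, 0, 0, -1, -3, 0, 0] := by
      funext k
      fin_cases k <;> simp [wcoeffs]
    have h := hPQ.2.2.2 (-3) 2
    have hP := congrArg (Algebra.ofId ℚ ℂ) h.1
    have hQ := congrArg (Algebra.ofId ℚ ℂ) h.2
    rw [aeval_map', e] at hP hQ
    rw [disc, hP, hQ]
    simp
    norm_num
  have h1 := disc_act P Q hPQ ![1, 0, 2, 0, 0, 0, -1, -3, 0, 0] !![1, 0, 0; 0, 1, 0; 1, 0, 1]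
  have e : actC !![1, 0, 0; 0, 1, 0; 1, 0, 1] ![1, 0, 2, 0, 0, 0, -1, -3, 0, 0]
      = (![1, 0, 0, 0, 3, 0, -1, 0, 0, 0] : Fin 10 → ℂ) := by
    funext k
    fin_cases k <;> simp [actC, polF, polG, polT]
    norm_num
  rw [e, hW, mul_zero, degen P Q hPQ _ (by simp) (by simp) (by simp)] at h1
  simpa using h1

theorem disc_zq (P Q : MvPolynomial (Fin 10) ℚ) (hPQ : IsInvariantPair ℚ P Q) (e f g : ℂ) :
    disc P Q ![0, 0, 0, 0, e, 0, f, 0, 0, g] = 0 := by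
  suffices h : ∃ l0 l1 m0 m1 : ℂ, e = 3 * l0 ^ 2 - m0 ^ 2 ∧ f = 3 * l1 ^ 2 - m1 ^ 2 ∧
      g = 6 * l0 * l1 - 2 * m0 * m1 by
    obtain ⟨l0, l1, m0, m1, he, hf, hg⟩ := h
    have h1 := disc_act P Q hPQ ![0, 0, 0, 0, 3, 0, -1, 0, 0, 0] !![l0, m0, 0; l1, m1, 0; 0, 0, 1]
    rw [disc_node P Q hPQ, mul_zero] at h1
    refine Eq.trans ?_ h1
    congr 1
    funext k
    fin_cases k <;> simp [actC, polF, polG, polT, he, hf, hg] <;> ring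
  by_cases he : e = 0
  · obtain ⟨s, hs⟩ := IsAlgClosed.exists_pow_nat_eq (3 : ℂ) (n := 2) (by norm_num)
    have hs0 : s ≠ 0 := by rintro rfl; norm_num at hs
    refine ⟨g / (2 * s), (1 + f) / (2 * s), g / 2, (f - 1) / 2, ?_, ?_, ?_⟩
    · rw [he]; field_simp; rw [hs]; ring
    · field_simp; rw [hs]; ring
    · field_simp; rw [hs]; ring
  · obtain ⟨s, hs⟩ := IsAlgClosed.exists_pow_nat_eq (e / 3 : ℂ) (n := 2) (by norm_num)
    obtain ⟨t, ht⟩ := IsAlgClosed.exists_pow_nat_eq (g ^ 2 / (4 * e) - f : ℂ) (n := 2) (by norm_num)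
    refine ⟨s, s * (g / (2 * e)), 0, t, ?_, ?_, ?_⟩
    · rw [hs]; ring
    · rw [mul_pow, hs, ht]; field_simp; ring
    · have : 6 * s * (s * (g / (2 * e))) = 6 * s ^ 2 * (g / (2 * e)) := by ring
      rw [this, hs]; field_simp; ring

theorem exists_row2 (v : Fin 3 → ℂ) (hv : v ≠ 0) :
    ∃ γ : Matrix (Fin 3) (Fin 3) ℂ, γ.det ≠ 0 ∧ γ 2 = v := by
  have : ∃ i, v i ≠ 0 := by
    by_contra! h
    exact hv (funext h)
  obtain ⟨i, hi⟩ := this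
  fin_cases i
  · refine ⟨Matrix.of ![![0, 1, 0], ![0, 0, 1], v], ?_, rfl⟩
    simpa [Matrix.det_fin_three] using hi
  · refine ⟨Matrix.of ![![1, 0, 0], ![0, 0, 1], v], ?_, rfl⟩
    simpa [Matrix.det_fin_three] using hi
  · refine ⟨Matrix.of ![![1, 0, 0], ![0, 1, 0], v], ?_, rfl⟩
    simpa [Matrix.det_fin_three] using hi

theorem exists_row1 (v : Fin 3 → ℂ) (hv : v ≠ 0) :
    ∃ γ : Matrix (Fin 3) (Fin 3) ℂ, γ.det ≠ 0 ∧ γ 1 = v := by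
  obtain ⟨γ, h, h2⟩ := exists_row2 v hv
  refine ⟨Matrix.of ![γ 0, γ 2, γ 1], ?_, h2⟩
  intro h3
  apply h
  rw [Matrix.det_fin_three] at h3 ⊢
  simp at h3
  linear_combination - h3

theorem disc_sing (P Q : MvPolynomial (Fin 10) ℚ) (hPQ : IsInvariantPair ℚ P Q)
    (c : Fin 10 → ℂ) (v : Fin 3 → ℂ) (hv : v ≠ 0) (hs : ∀ w, polG c v w = 0) :
    disc P Q c = 0 := by
  obtain ⟨γ, h, h2⟩ := exists_row2 v hv
  have h1 := disc_act P Q hPQ c γ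
  rw [degen P Q hPQ, disc_zq P Q hPQ] at h1
  · simpa [h] using h1.symm
  · have := hs v
    simp only [actC, h2, polF, polG] at this ⊢
    simp
    linear_combination this / 3
  · simpa [actC, h2] using hs _
  · simpa [actC, h2] using hs _

theorem common_zero (f g : MvPolynomial (Fin 3) ℂ) (hf : eval 0 f = 0) (hg : eval 0 g = 0) :
    ∃ v : Fin 3 → ℂ, v ≠ 0 ∧ eval v f = 0 ∧ eval v g = 0 := by
  by_contra! hcon
  let I : Ideal (MvPolynomial (Fin 3) ℂ) := Ideal.span {f, g}
  let ψ : (Fin 3 → MvPolynomial (Fin 3) ℂ) → (MvPolynomial (Fin 3) ℂ →ₐ[ℂ] MvPolynomial (Fin 3) ℂ) :=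
    fun a => aeval a
  let p : (Fin 3 → MvPolynomial (Fin 3) ℂ) → Ideal (MvPolynomial (Fin 3) ℂ) :=
    fun a => RingHom.ker (ψ a)
  have hprime : ∀ a, (p a).IsPrime := fun a => RingHom.ker_isPrime _
  let a1 : Fin 3 → MvPolynomial (Fin 3) ℂ := ![0, X 1, X 2]
  let a2 : Fin 3 → MvPolynomial (Fin 3) ℂ := ![0, 0, X 2]
  let a3 : Fin 3 → MvPolynomial (Fin 3) ℂ := ![0, 0, 0]
  have comp : ∀ a b : Fin 3 → MvPolynomial (Fin 3) ℂ, (∀ i, ψ b (a i) = b i) → p a ≤ p b := by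
    intro a b hab q hq
    have hq' : ψ a q = 0 := hq
    change ψ b q = 0
    have : (ψ b).comp (ψ a) = ψ b := by
      ext1 i
      simp only [AlgHom.comp_apply]
      rw [show ψ a (X i) = a i from aeval_X _ _, hab, show ψ b (X i) = b i from aeval_X _ _]
    rw [← this, AlgHom.comp_apply, hq', map_zero]
  have l01 : (⊥ : Ideal (MvPolynomial (Fin 3) ℂ)) < p a1 := by
    rw [bot_lt_iff_ne_bot]
    intro h
    have : (X 0 : MvPolynomial (Fin 3) ℂ) ∈ p a1 := by
      change ψ a1 (X 0) = 0
      simp [ψ, a1]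
    rw [h] at this
    exact X_ne_zero _ this
  have l12 : p a1 < p a2 := by
    refine lt_of_le_of_ne (comp _ _ ?_) ?_
    · intro i; fin_cases i <;> simp [ψ, a1, a2]
    · intro h
      have : (X 1 : MvPolynomial (Fin 3) ℂ) ∈ p a2 := by
        change ψ a2 (X 1) = 0
        simp [ψ, a2]
      rw [← h] at this
      have h' : ψ a1 (X 1) = 0 := this
      simp [ψ, a1] at h'
  have l23 : p a2 < p a3 := by
    refine lt_of_le_of_ne (comp _ _ ?_) ?_
    · intro i; fin_cases i <;> simp [ψ, a2, a3]
    · intro h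
      have : (X 2 : MvPolynomial (Fin 3) ℂ) ∈ p a3 := by
        change ψ a3 (X 2) = 0
        simp [ψ, a3]
      rw [← h] at this
      have h' : ψ a2 (X 2) = 0 := this
      simp [ψ, a2] at h'
  have := hprime a1
  have := hprime a2
  have := hprime a3
  have hbot : (⊥ : Ideal (MvPolynomial (Fin 3) ℂ)).IsPrime := Ideal.isPrime_bot
  have k1 := Ideal.height_add_one_le_of_lt_of_isPrime l01
  have k2 := Ideal.height_add_one_le_of_lt_of_isPrime l12
  have k3 := Ideal.height_add_one_le_of_lt_of_isPrime l23
  have h3 : (3 : ℕ∞) ≤ (p a3).height := by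
    calc (3 : ℕ∞) = 0 + 1 + 1 + 1 := by norm_num
      _ ≤ (⊥ : Ideal (MvPolynomial (Fin 3) ℂ)).height + 1 + 1 + 1 := by gcongr; exact zero_le
      _ ≤ _ := (by gcongr : _ ≤ (p a1).height + 1 + 1).trans ((by gcongr : _ ≤ (p a2).height + 1).trans k3)
  have hev : ∀ q, q ∈ p a3 ↔ eval 0 q = 0 := by
    intro q
    have : ψ a3 q = C (eval 0 q) := by
      have e : ψ a3 = (Algebra.ofId ℂ (MvPolynomial (Fin 3) ℂ)).comp (aeval (0 : Fin 3 → ℂ)) := by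
        ext1 i
        fin_cases i <;> simp [ψ, a3]
      rw [e, AlgHom.comp_apply]
      rfl
    change ψ a3 q = 0 ↔ _
    rw [this, C_eq_zero]
  have hrad : I.radical = p a3 := by
    rw [← vanishingIdeal_zeroLocus_eq_radical (K := ℂ) I]
    ext q
    rw [mem_vanishingIdeal_iff, hev]
    constructor
    · intro h
      have := h 0 ?_
      · simpa [aeval_def, eval] using this
      · simp only [I, zeroLocus_span]
        intro r hr
        rcases hr with rfl | rfl
        · simpa [aeval_def, eval] using hf
        · simpa [aeval_def, eval] using hg
    · intro h x hx
      simp only [I, zeroLocus_span] at hx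
      have hx1 : eval x f = 0 := hx f (by simp)
      have hx2 : eval x g = 0 := hx g (by simp)
      have hx0 : x = 0 := by
        by_contra hne
        exact hcon x hne hx1 hx2
      subst hx0
      simpa [aeval_def, eval] using h
  have hmin : p a3 ∈ I.minimalPrimes := by
    rw [← Ideal.radical_minimalPrimes, hrad, Ideal.minimalPrimes_eq_subsingleton_self]
    rfl
  have hle := Ideal.height_le_card_of_mem_minimalPrimes_span (s := {f, g}) (by simp) hmin
  have hc : ({f, g} : Set (MvPolynomial (Fin 3) ℂ)).ncard ≤ 2 := Set.ncard_insert_le _ _ |>.trans (by simp)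
  have : (3 : ℕ∞) ≤ 2 := h3.trans (hle.trans (by exact_mod_cast hc))
  exact absurd this (by decide)

/-- The stabilizer in `SL₃(ℂ)` has 27 elements. -/
def Good (c : Fin 10 → ℂ) : Prop :=
  {γ : Matrix.SpecialLinearGroup (Fin 3) ℂ |
      actC (γ : Matrix (Fin 3) (Fin 3) ℂ) c = c}.ncard = 27

theorem good_act (c : Fin 10 → ℂ) (γ : Matrix (Fin 3) (Fin 3) ℂ) (hγ : γ.det ≠ 0)
    (h : Good (actC γ c)) : Good c := by
  have hu : IsUnit γ.det := isUnit_iff_ne_zero.mpr hγ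
  have hi1 : γ * γ⁻¹ = 1 := Matrix.mul_nonsing_inv γ hu
  have hi2 : γ⁻¹ * γ = 1 := Matrix.nonsing_inv_mul γ hu
  have hd : γ⁻¹.det * γ.det = 1 := by rw [← Matrix.det_mul, hi2, Matrix.det_one]
  let φ : Matrix.SpecialLinearGroup (Fin 3) ℂ → Matrix.SpecialLinearGroup (Fin 3) ℂ :=
    fun δ => ⟨γ⁻¹ * δ.1 * γ, by
      rw [Matrix.det_mul, Matrix.det_mul, δ.2, mul_one, hd]⟩
  have hinj : Function.Injective φ := by
    intro a b hab
    have h1 : γ⁻¹ * a.1 * γ = γ⁻¹ * b.1 * γ := congrArg Subtype.val hab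
    apply Subtype.ext
    have h2 : γ * (γ⁻¹ * a.1 * γ) * γ⁻¹ = γ * (γ⁻¹ * b.1 * γ) * γ⁻¹ := by rw [h1]
    simpa only [mul_assoc, hi1, mul_one, ← mul_assoc γ γ⁻¹, one_mul] using h2
  rw [Good, ← h, Eq.comm]
  rw [← Set.ncard_image_of_injective _ hinj]
  symm
  congr 1
  ext ε
  constructor
  · intro hε
    have hε : actC ε.1 c = c := hε
    refine ⟨⟨γ * ε.1 * γ⁻¹, by rw [Matrix.det_mul, Matrix.det_mul, ε.2, mul_one, mul_comm, hd]⟩, ?_, ?_⟩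
    · change actC (γ * ε.1 * γ⁻¹) (actC γ c) = actC γ c
      rw [actC_mul, mul_assoc, hi2, mul_one, ← actC_mul, hε]
    · apply Subtype.ext
      change γ⁻¹ * (γ * ε.1 * γ⁻¹) * γ = ε.1
      simp only [mul_assoc, hi2, mul_one]
      rw [← mul_assoc, hi2, one_mul]
  · rintro ⟨δ, hδ, rfl⟩
    have hδ : actC δ.1 (actC γ c) = actC γ c := hδ
    change actC (γ⁻¹ * δ.1 * γ) c = c
    rw [← actC_mul, ← actC_mul, hδ, actC_mul, hi2, actC_one]

theorem row_one {a b c d e f g h i : ℂ} (h0 : a * b * c = 0)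
    (h1 : d * b * c + a * e * c + a * b * f = 0) (h2 : g * b * c + a * h * c + a * b * i = 0)
    (hdet : a * (e * i - f * h) - b * (d * i - f * g) + c * (d * h - e * g) = 1) :
    (b = 0 ∧ c = 0) ∨ (a = 0 ∧ c = 0) ∨ (a = 0 ∧ b = 0) := by
  rcases mul_eq_zero.mp h0 with hab | hc
  · rcases mul_eq_zero.mp hab with ha | hb
    · subst ha
      by_cases hb : b = 0
      · simp [hb]
      by_cases hc : c = 0
      · simp [hc]
      have hd : d = 0 := by simpa [hb, hc] using h1
      have hg : g = 0 := by simpa [hb, hc] using h2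
      simp [hd, hg] at hdet
    · subst hb
      by_cases ha : a = 0
      · simp [ha]
      by_cases hc : c = 0
      · simp [hc]
      have hd : e = 0 := by simpa [ha, hc] using h1
      have hg : h = 0 := by simpa [ha, hc] using h2
      simp [hd, hg] at hdet
  · subst hc
    by_cases ha : a = 0
    · simp [ha]
    by_cases hb : b = 0
    · simp [hb]
    have hd : f = 0 := by simpa [ha, hb] using h1
    have hg : i = 0 := by simpa [ha, hb] using h2
    simp [hd, hg] at hdet

/-- The Hesse form. -/
def hesse (m : ℂ) : Fin 10 → ℂ := ![1, 1, 1, 0, 0, 0, 0, 0, 0, 3 * m]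

/-- The 27 matrices. -/
def heis (a b c : ℂ) : Fin 3 → Matrix (Fin 3) (Fin 3) ℂ :=
  ![!![a, 0, 0; 0, b, 0; 0, 0, c], !![0, a, 0; 0, 0, b; c, 0, 0], !![0, 0, a; b, 0, 0; 0, c, 0]]

set_option maxHeartbeats 4000000 in
theorem hesse_stab (m : ℂ) (hm : m ^ 3 ≠ -1) (γ : Matrix (Fin 3) (Fin 3) ℂ) (hdet : γ.det = 1)
    (h : actC γ (hesse m) = hesse m) :
    ∃ a b c : ℂ, a ^ 3 = 1 ∧ b ^ 3 = 1 ∧ a * b * c = 1 ∧ ∃ k, γ = heis a b c k := by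
  have hH : hessC (hesse m) = ![-54 * m ^ 2, -54 * m ^ 2, -54 * m ^ 2, 0, 0, 0, 0, 0, 0,
      216 + 54 * m ^ 3] := by
    funext k
    fin_cases k <;> simp [hessC, hesse] <;> ring
  have h2 := hessC_actC γ (hesse m)
  rw [h, hdet, one_pow, one_smul] at h2
  have hm1 : 216 * (1 + m ^ 3) ≠ 0 := by
    intro h0
    apply hm
    linear_combination h0 / 216
  have hxyz : actC γ ![0, 0, 0, 0, 0, 0, 0, 0, 0, 1] = ![0, 0, 0, 0, 0, 0, 0, 0, 0, 1] := by
    have e : (216 * (1 + m ^ 3)) • (![0, 0, 0, 0, 0, 0, 0, 0, 0, 1] : Fin 10 → ℂ)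
        = hessC (hesse m) + (54 * m ^ 2) • hesse m := by
      rw [hH]
      funext k
      fin_cases k <;> simp [hesse] <;> ring
    have e2 := congrArg (actC γ) e
    rw [actC_add, actC_smul, actC_smul, ← h2, h, ← e] at e2
    funext k
    have := congrFun e2 k
    simpa only [Pi.smul_apply, smul_eq_mul, mul_right_inj' hm1] using this
  have hsum : actC γ ![1, 1, 1, 0, 0, 0, 0, 0, 0, 0] = ![1, 1, 1, 0, 0, 0, 0, 0, 0, 0] := by
    have e : (![1, 1, 1, 0, 0, 0, 0, 0, 0, 0] : Fin 10 → ℂ)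
        = hesse m + (- (3 * m)) • ![0, 0, 0, 0, 0, 0, 0, 0, 0, 1] := by
      funext k
      fin_cases k <;> simp [hesse]
    rw [e, actC_add, actC_smul, h, hxyz]
  clear h
  have x0 := congrFun hxyz 0
  have x1 := congrFun hxyz 1
  have x2 := congrFun hxyz 2
  have x3 := congrFun hxyz 3
  have x4 := congrFun hxyz 4
  have x5 := congrFun hxyz 5
  have x6 := congrFun hxyz 6
  have x7 := congrFun hxyz 7
  have x8 := congrFun hxyz 8
  have x9 := congrFun hxyz 9
  have s0 := congrFun hsum 0
  have s1 := congrFun hsum 1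
  have s2 := congrFun hsum 2
  rw [Matrix.det_fin_three] at hdet
  obtain ⟨a, ha⟩ : ∃ a, a = γ 0 0 := ⟨_, rfl⟩
  obtain ⟨b, hb⟩ : ∃ a, a = γ 0 1 := ⟨_, rfl⟩
  obtain ⟨c, hc⟩ : ∃ a, a = γ 0 2 := ⟨_, rfl⟩
  obtain ⟨d, hd⟩ : ∃ a, a = γ 1 0 := ⟨_, rfl⟩
  obtain ⟨e, he⟩ : ∃ a, a = γ 1 1 := ⟨_, rfl⟩
  obtain ⟨f, hf⟩ : ∃ a, a = γ 1 2 := ⟨_, rfl⟩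
  obtain ⟨g, hg⟩ : ∃ a, a = γ 2 0 := ⟨_, rfl⟩
  obtain ⟨h, hh⟩ : ∃ a, a = γ 2 1 := ⟨_, rfl⟩
  obtain ⟨i, hi⟩ : ∃ a, a = γ 2 2 := ⟨_, rfl⟩
  have hγ : γ = !![a, b, c; d, e, f; g, h, i] := by
    ext i j
    fin_cases i <;> fin_cases j <;> simp [*]
  simp [actC, polF, polG, polT, ← ha, ← hb, ← hc, ← hd, ← he, ← hf, ← hg, ← hh, ← hi,
    -mul_eq_zero] at x0 x1 x2 x3 x4 x5 x6 x7 x8 x9 s0 s1 s2 hdet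
  have r0 := row_one (a := a) (b := b) (c := c) (d := d) (e := e) (f := f) (g := g) (h := h) (i := i)
    x0 (by linear_combination x3) (by linear_combination x4) (by linear_combination hdet)
  have r1 := row_one (a := d) (b := e) (c := f) (d := g) (e := h) (f := i) (g := a) (h := b) (i := c)
    x1 (by linear_combination x6) (by linear_combination x5) (by linear_combination hdet)
  have r2 := row_one (a := g) (b := h) (c := i) (d := a) (e := b) (f := c) (g := d) (h := e) (i := f)
    x2 (by linear_combination x7) (by linear_combination x8) (by linear_combination hdet)
  clear ha hb hc hd he hf hg hh hi x0 x1 x2 x3 x4 x5 x6 x7 x8 hxyz hsum hH h2 hm1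
  subst hγ
  rcases r0 with ⟨rfl, rfl⟩ | ⟨rfl, rfl⟩ | ⟨rfl, rfl⟩ <;>
  rcases r1 with ⟨rfl, rfl⟩ | ⟨rfl, rfl⟩ | ⟨rfl, rfl⟩ <;>
  rcases r2 with ⟨rfl, rfl⟩ | ⟨rfl, rfl⟩ | ⟨rfl, rfl⟩ <;>
  simp at s0 s1 s2 hdet x9 <;>
  first
  | exact ⟨a, e, i, s0, s1, by linear_combination hdet, 0, rfl⟩
  | exact ⟨b, f, g, s0, s1, by linear_combination hdet, 1, rfl⟩
  | exact ⟨c, d, h, s0, s1, by linear_combination hdet, 2, rfl⟩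
  | (exfalso; have : (2 : ℂ) = 0 := by linear_combination - hdet - x9
     norm_num at this)

theorem heis_stab (m a b c : ℂ) (ha : a ^ 3 = 1) (hb : b ^ 3 = 1) (habc : a * b * c = 1) (k : Fin 3) :
    (heis a b c k).det = 1 ∧ actC (heis a b c k) (hesse m) = hesse m := by
  have hc : c ^ 3 = 1 := by
    have : (a * b * c) ^ 3 = 1 := by rw [habc, one_pow]
    rw [mul_pow, mul_pow, ha, hb] at this
    simpa using this
  have hacb : a * c * b = 1 := by linear_combination habc
  constructor
  · fin_cases k <;> simp [heis, Matrix.det_fin_three] <;> linear_combination habc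
  · funext j
    fin_cases k <;> fin_cases j <;>
      simp [heis, actC, polF, polG, polT, hesse, ha, hb, hc] <;>
      linear_combination 3 * m * habc

theorem good_hesse (m : ℂ) (hm : m ^ 3 ≠ -1) : Good (hesse m) := by
  obtain ⟨ω, hω⟩ : ∃ ω : ℂ, IsPrimitiveRoot ω 3 :=
    ⟨_, Complex.isPrimitiveRoot_exp 3 (by norm_num)⟩
  have hω3 : ω ^ 3 = 1 := hω.pow_eq_one
  have hω0 : ω ≠ 0 := hω.ne_zero (by norm_num)
  have hc3 : ∀ i : ℕ, (ω ^ i) ^ 3 = 1 := fun i => by rw [← pow_mul, mul_comm, pow_mul, hω3, one_pow]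
  have habc : ∀ i j : ℕ, ω ^ i * ω ^ j * ((ω ^ i) ^ 2 * (ω ^ j) ^ 2) = 1 := fun i j => by
    have h1 := hc3 i
    have h2 := hc3 j
    linear_combination (ω ^ j) ^ 3 * h1 + h2
  let φ : Fin 3 × Fin 3 × Fin 3 → Matrix.SpecialLinearGroup (Fin 3) ℂ := fun p =>
    ⟨heis (ω ^ (p.1 : ℕ)) (ω ^ (p.2.1 : ℕ)) ((ω ^ (p.1 : ℕ)) ^ 2 * (ω ^ (p.2.1 : ℕ)) ^ 2) p.2.2,
      (heis_stab m _ _ _ (hc3 _) (hc3 _) (habc _ _) _).1⟩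
  have hinj : Function.Injective φ := by
    rintro ⟨i, j, k⟩ ⟨i', j', k'⟩ h
    have h1 : heis _ _ _ k = heis _ _ _ k' := congrArg Subtype.val h
    have hne : ∀ n : ℕ, ω ^ n ≠ 0 := fun n => pow_ne_zero _ hω0
    have e00 := congrFun (congrFun h1 0) 0
    have e01 := congrFun (congrFun h1 0) 1
    have e02 := congrFun (congrFun h1 0) 2
    have e10 := congrFun (congrFun h1 1) 0
    have e11 := congrFun (congrFun h1 1) 1
    have e12 := congrFun (congrFun h1 1) 2
    clear h h1
    have key : ∀ i j : Fin 3, ω ^ (i : ℕ) = ω ^ (j : ℕ) → i = j :=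
      fun i j h => Fin.ext (hω.pow_inj i.2 j.2 h)
    have : k = k' := by
      fin_cases k <;> fin_cases k' <;> simp [heis, hω0] at e00 e01 e02 ⊢
    subst this
    have : i = i' ∧ j = j' := by
      fin_cases k <;> simp [heis] at e00 e01 e02 e10 e11 e12 <;>
      refine ⟨key _ _ (by assumption), key _ _ (by assumption)⟩
    rw [this.1, this.2]
  have himg : {γ : Matrix.SpecialLinearGroup (Fin 3) ℂ |
      actC (γ : Matrix (Fin 3) (Fin 3) ℂ) (hesse m) = hesse m} = φ '' Set.univ := by
    ext γ
    constructor
    · intro h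
      obtain ⟨a, b, c, ha, hb, hh, k, hk⟩ := hesse_stab m hm γ.1 γ.2 h
      obtain ⟨i, hi, rfl⟩ := hω.eq_pow_of_pow_eq_one ha
      obtain ⟨j, hj, rfl⟩ := hω.eq_pow_of_pow_eq_one hb
      refine ⟨(⟨i, hi⟩, ⟨j, hj⟩, k), trivial, ?_⟩
      apply Subtype.ext
      rw [hk]
      have : c = (ω ^ i) ^ 2 * (ω ^ j) ^ 2 := by
        have h1 := habc i j
        have h2 : ω ^ i * ω ^ j ≠ 0 := mul_ne_zero (pow_ne_zero _ hω0) (pow_ne_zero _ hω0)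
        exact mul_left_cancel₀ h2 (hh.trans h1.symm)
      rw [this]
    · rintro ⟨p, -, rfl⟩
      exact (heis_stab m _ _ _ (hc3 _) (hc3 _) (habc _ _) _).2
  rw [Good, himg, Set.ncard_image_of_injective _ hinj, Set.ncard_univ]
  simp

/-- Nondegenerate coefficient vectors. -/
def Nd (c : Fin 10 → ℂ) : Prop :=
  ∃ P Q : MvPolynomial (Fin 10) ℚ, IsInvariantPair ℚ P Q ∧ disc P Q c ≠ 0

theorem Nd.sing {c : Fin 10 → ℂ} (h : Nd c) (x y z : ℂ) (hv : x ≠ 0 ∨ y ≠ 0 ∨ z ≠ 0)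
    (h0 : 3 * c 0 * x ^ 2 + 2 * c 3 * x * y + 2 * c 4 * x * z + c 5 * y ^ 2 + c 7 * z ^ 2
      + c 9 * y * z = 0)
    (h1 : 3 * c 1 * y ^ 2 + c 3 * x ^ 2 + 2 * c 5 * x * y + 2 * c 6 * y * z + c 8 * z ^ 2
      + c 9 * x * z = 0)
    (h2 : 3 * c 2 * z ^ 2 + c 4 * x ^ 2 + c 6 * y ^ 2 + 2 * c 7 * x * z + 2 * c 8 * y * z
      + c 9 * x * y = 0) : False := by
  obtain ⟨P, Q, hPQ, hd⟩ := h
  apply hd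
  apply disc_sing P Q hPQ c ![x, y, z]
  · intro h
    have e0 := congrFun h 0
    have e1 := congrFun h 1
    have e2 := congrFun h 2
    simp at e0 e1 e2
    simp [e0, e1, e2] at hv
  · intro w
    simp only [polG, Matrix.cons_val_zero, Matrix.cons_val_one, Matrix.cons_val]
    rw [h0, h1, h2]
    ring

theorem Nd.act {c : Fin 10 → ℂ} (h : Nd c) (γ : Matrix (Fin 3) (Fin 3) ℂ) (hγ : γ.det ≠ 0) :
    Nd (actC γ c) := by
  obtain ⟨P, Q, hPQ, hd⟩ := h
  refine ⟨P, Q, hPQ, ?_⟩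
  rw [disc_act P Q hPQ]
  exact mul_ne_zero (pow_ne_zero _ hγ) hd

theorem reduce {c : Fin 10 → ℂ} (d : Fin 10 → ℂ) (γ : Matrix (Fin 3) (Fin 3) ℂ) (h : Nd c)
    (hγ : γ.det ≠ 0) (hd : actC γ c = d) (hg : Nd d → Good d) : Good c := by
  subst hd
  exact good_act c γ hγ (hg (h.act γ hγ))

theorem good_hesse' (m : ℂ) (h : Nd (hesse m)) : Good (hesse m) := by
  apply good_hesse
  intro hm
  apply h.sing (-m ^ 2) (-1) (-1)
  · right; left; norm_num
  · simp [hesse]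
    linear_combination 3 * m * hm
  · simp [hesse]
    linear_combination 3 * hm
  · simp [hesse]
    linear_combination 3 * hm

theorem good_diag (a b c e : ℂ) (ha : a ≠ 0) (hb : b ≠ 0) (hc : c ≠ 0)
    (h : Nd ![a, b, c, 0, 0, 0, 0, 0, 0, e]) : Good ![a, b, c, 0, 0, 0, 0, 0, 0, e] := by
  obtain ⟨r, rfl⟩ := IsAlgClosed.exists_pow_nat_eq a (n := 3) (by norm_num)
  obtain ⟨s, rfl⟩ := IsAlgClosed.exists_pow_nat_eq b (n := 3) (by norm_num)
  obtain ⟨t, rfl⟩ := IsAlgClosed.exists_pow_nat_eq c (n := 3) (by norm_num)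
  have hr : r ≠ 0 := by rintro rfl; simp at ha
  have hs : s ≠ 0 := by rintro rfl; simp at hb
  have ht : t ≠ 0 := by rintro rfl; simp at hc
  refine reduce (hesse (e / (3 * r * s * t))) !![r⁻¹, 0, 0; 0, s⁻¹, 0; 0, 0, t⁻¹] h ?_ ?_
    (good_hesse' _)
  · simp [Matrix.det_fin_three, hr, hs, ht]
  · funext k
    fin_cases k <;> simp [actC, polF, polG, polT, hesse] <;> field_simp

theorem good_sum (m : ℂ) (hm : m ≠ 0) (h : Nd ![1, 1, 1, 3, 3, 3, 3, 3, 3, 6 + m]) :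
    Good ![1, 1, 1, 3, 3, 3, 3, 3, 3, 6 + m] := by
  obtain ⟨w, hw⟩ : ∃ w : ℂ, IsPrimitiveRoot w 3 :=
    ⟨_, Complex.isPrimitiveRoot_exp 3 (by norm_num)⟩
  have h1 : w ^ 2 + w + 1 = 0 := by
    have h3 : w ^ 3 = 1 := hw.pow_eq_one
    have hne : w - 1 ≠ 0 := sub_ne_zero.mpr (hw.ne_one (by norm_num))
    apply mul_left_cancel₀ hne
    linear_combination h3
  have h2 : w ^ 2 = - w - 1 := by linear_combination h1
  have h3 : w ^ 3 = 1 := hw.pow_eq_one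
  refine reduce ![27 + m, m, m, 0, 0, 0, 0, 0, 0, -3 * m]
    !![1, 1, 1; 1, w, - w - 1; 1, - w - 1, w] h ?_ ?_ ?_
  · intro h0
    simp [Matrix.det_fin_three] at h0
    have : (27 : ℂ) = 0 := by
      have h4 : -3 * (2 * w + 1) = 0 := by linear_combination h0
      linear_combination 3 * (2 * w + 1) * h4 + 36 * h1
    norm_num at this
  · funext k
    fin_cases k <;> simp [actC, polF, polG, polT] <;> ring_nf <;>
      (try simp only [h2, h3]) <;> (try ring)
  · intro hn
    refine good_diag _ _ _ _ ?_ hm hm hn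
    intro h0
    apply hn.sing 1 0 0 (by simp) <;> simp [h0]

theorem good_weier_aux (l u : ℂ) (hl : l ≠ 0)
    (h : Nd ![1, 0, u ^ 2 - l ^ 6 / 27, 0, 0, 0, -1, l ^ 4 / 3 + 2 * l * u, 0, 0]) :
    Good ![1, 0, u ^ 2 - l ^ 6 / 27, 0, 0, 0, -1, l ^ 4 / 3 + 2 * l * u, 0, 0] := by
  by_cases ha : u / l + l ^ 2 / 3 = 0
  · exfalso
    have hu : u = - l ^ 3 / 3 := by
      field_simp at ha
      linear_combination ha / 3
    subst hu
    apply h.sing (l ^ 2 / 3) 0 1 (by simp) <;> simp <;> ring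
  obtain ⟨a, rfl⟩ : ∃ a, u = l * (- a - l ^ 2 / 3) := ⟨- (u / l + l ^ 2 / 3), by field_simp; ring⟩
  have ha' : a ≠ 0 := by
    rintro rfl
    apply ha
    field_simp
    ring
  refine reduce ![1, 1, 1, 3, 3, 3, 3, 3, 3, 6 + 4 * l ^ 2 / a]
    !![1 + l ^ 2 / 3 / a, 0, 1 / a; 1, -l, 0; 1, l, 0] h ?_ ?_ (good_sum _ ?_)
  · simp [Matrix.det_fin_three, ha', hl]
  · funext k
    fin_cases k <;> simp [actC, polF, polG, polT] <;> field_simp <;> (try ring)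
  · simp [ha', hl]

theorem good_weier (A B : ℂ) (h : Nd ![1, 0, B, 0, 0, 0, -1, A, 0, 0]) :
    Good ![1, 0, B, 0, 0, 0, -1, A, 0, 0] := by
  have hL : ∃ L : ℂ, L ≠ 0 ∧ L ^ 4 + 18 * A * L ^ 2 + 108 * B * L - 27 * A ^ 2 = 0 := by
    by_cases hA : A = 0
    · subst hA
      obtain ⟨L, hL⟩ := IsAlgClosed.exists_pow_nat_eq (-108 * B) (n := 3) (by norm_num)
      refine ⟨L, ?_, by linear_combination L * hL⟩
      rintro rfl
      have hB : B = 0 := by simpa using hL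
      subst hB
      apply h.sing 0 0 1 (by simp) <;> simp
    · let p : Polynomial ℂ := Polynomial.X ^ 4 + (Polynomial.C (18 * A) * Polynomial.X ^ 2
        + Polynomial.C (108 * B) * Polynomial.X + Polynomial.C (- 27 * A ^ 2))
      have hp : p.degree = 4 := by
        simp only [p]
        compute_degree!
      obtain ⟨L, hL⟩ := IsAlgClosed.exists_root p (by rw [hp]; norm_num)
      have hL' : L ^ 4 + 18 * A * L ^ 2 + 108 * B * L - 27 * A ^ 2 = 0 := by
        simp [p, Polynomial.IsRoot] at hL
        linear_combination hL
      refine ⟨L, ?_, hL'⟩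
      rintro rfl
      apply hA
      simpa using hL'
  obtain ⟨L, hL0, hL⟩ := hL
  obtain ⟨l, rfl⟩ := IsAlgClosed.exists_pow_nat_eq L (n := 2) (by norm_num)
  have hl : l ≠ 0 := by rintro rfl; simp at hL0
  obtain ⟨u, rfl⟩ : ∃ u, A = l ^ 4 / 3 + 2 * l * u := ⟨(A - l ^ 4 / 3) / (2 * l), by field_simp; ring⟩
  obtain rfl : B = u ^ 2 - l ^ 6 / 27 := by
    apply mul_left_cancel₀ (pow_ne_zero 2 hl)
    linear_combination hL / 108
  exact good_weier_aux l u hl h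

theorem good_w3 (a c d e : ℂ) (ha : a ≠ 0) (he : e ≠ 0)
    (h : Nd ![a, 0, d, 0, 0, 0, e, c, 0, 0]) : Good ![a, 0, d, 0, 0, 0, e, c, 0, 0] := by
  obtain ⟨s, rfl⟩ := IsAlgClosed.exists_pow_nat_eq a (n := 3) (by norm_num)
  obtain ⟨t, ht⟩ := IsAlgClosed.exists_pow_nat_eq (-e) (n := 2) (by norm_num)
  obtain rfl : e = - t ^ 2 := by rw [ht, neg_neg]
  have hs : s ≠ 0 := by rintro rfl; simp at ha
  have ht : t ≠ 0 := by rintro rfl; simp at he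
  refine reduce ![1, 0, d, 0, 0, 0, -1, c / s, 0, 0] !![s⁻¹, 0, 0; 0, t⁻¹, 0; 0, 0, 1] h ?_ ?_
    (good_weier _ _)
  · simp [Matrix.det_fin_three, hs, ht]
  · funext k
    fin_cases k <;> simp [actC, polF, polG, polT] <;> field_simp

theorem good_w2 (a b c d e : ℂ) (ha : a ≠ 0) (he : e ≠ 0)
    (h : Nd ![a, 0, d, 0, b, 0, e, c, 0, 0]) : Good ![a, 0, d, 0, b, 0, e, c, 0, 0] := by
  obtain ⟨r, rfl⟩ : ∃ r, b = 3 * a * r := ⟨b / (3 * a), by field_simp⟩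
  refine reduce ![a, 0, d - c * r + 2 * a * r ^ 3, 0, 0, 0, e, c - 3 * a * r ^ 2, 0, 0]
    !![1, 0, 0; 0, 1, 0; -r, 0, 1] h ?_ ?_ (good_w3 _ _ _ _ ha he)
  · simp [Matrix.det_fin_three]
  · funext k
    fin_cases k <;> simp [actC, polF, polG, polT] <;> ring

theorem good_w1 (a b c d e p q : ℂ) (he : e ≠ 0)
    (h : Nd ![a, 0, d, 0, b, 0, e, c, q, p]) : Good ![a, 0, d, 0, b, 0, e, c, q, p] := by
  obtain ⟨r, rfl⟩ : ∃ r, p = 2 * e * r := ⟨p / (2 * e), by field_simp⟩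
  obtain ⟨s, rfl⟩ : ∃ s, q = 2 * e * s := ⟨q / (2 * e), by field_simp⟩
  have ha : a ≠ 0 := by
    rintro rfl
    obtain ⟨t, ht⟩ := IsAlgClosed.exists_pow_nat_eq (r ^ 2 - b / e) (n := 2) (by norm_num)
    obtain rfl : b = e * (r ^ 2 - t ^ 2) := by rw [ht]; field_simp; ring
    apply h.sing 1 (t - r) 0 (by simp) <;> simp
    ring
  refine reduce ![a, 0, d - e * s ^ 2, 0, b - e * r ^ 2, 0, e, c - 2 * e * r * s, 0, 0]
    !![1, -r, 0; 0, 1, 0; 0, -s, 1] h ?_ ?_ (good_w2 _ _ _ _ _ ha he)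
  · simp [Matrix.det_fin_three]
  · funext k
    fin_cases k <;> simp [actC, polF, polG, polT] <;> ring

theorem good_flex2 (c : Fin 10 → ℂ) (h1 : c 1 = 0) (hH : hessC c 1 = 0) (h6 : c 6 ≠ 0)
    (h : Nd c) : Good c := by
  have hex : ∀ d : Fin 10 → ℂ, d 1 = 0 → d 5 = 0 → hessC d 1 = 0 → d 6 ≠ 0 → Nd d → Good d := by
    intro d d1 d5 dH d6 hd
    have d3 : d 3 = 0 := by simpa [hessC, d1, d5, d6] using dH
    have e : d = ![d 0, 0, d 2, 0, d 4, 0, d 6, d 7, d 8, d 9] := by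
      funext k
      fin_cases k <;> simp [d1, d3, d5]
    rw [e] at hd ⊢
    exact good_w1 _ _ _ _ _ _ _ d6 hd
  have hdet : (!![1, 0, - (c 5 / c 6); 0, 1, 0; 0, 0, 1] : Matrix (Fin 3) (Fin 3) ℂ).det = 1 := by
    simp [Matrix.det_fin_three]
  refine reduce _ !![1, 0, - (c 5 / c 6); 0, 1, 0; 0, 0, 1] h (by rw [hdet]; norm_num) rfl
    (hex _ ?_ ?_ ?_ ?_)
  · simp [actC, polF, h1]
  · simp [actC, polG, h1]
    field_simp
    ring
  · rw [hessC_actC, hdet]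
    simp [actC, polF, hH]
  · simpa [actC, polG, h1] using h6

theorem good_flex (c : Fin 10 → ℂ) (h1 : c 1 = 0) (hH : hessC c 1 = 0) 
    (h : Nd c) : Good c := by
  by_cases h6 : c 6 = 0
  · have h5 : c 5 ≠ 0 := by
      intro h5
      apply h.sing 0 1 0 (by simp) <;> simp [h1, h5, h6]
    have hdet : (!![0, 0, 1; 0, 1, 0; 1, 0, 0] : Matrix (Fin 3) (Fin 3) ℂ).det = -1 := by
      simp [Matrix.det_fin_three]
    refine reduce _ !![0, 0, 1; 0, 1, 0; 1, 0, 0] h (by rw [hdet]; norm_num) rfl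
      (good_flex2 _ ?_ ?_ ?_)
    · simp [actC, polF, h1]
    · rw [hessC_actC, hdet]
      simp [actC, polF, hH]
    · simpa [actC, polG, h1] using h5
  · exact good_flex2 c h1 hH h6 h

theorem good_of_nd (c : Fin 10 → ℂ) (h : Nd c) : Good c := by
  obtain ⟨v, hv, e1, e2⟩ := common_zero (cubic c) (cubic (hessC c))
    (by rw [eval_cubic]; simp [polF]) (by rw [eval_cubic]; simp [polF])
  rw [eval_cubic] at e1 e2
  obtain ⟨γ, hγ, rfl⟩ := exists_row1 v hv
  refine reduce _ γ h hγ rfl (good_flex _ ?_ ?_)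
  · simpa [actC] using e1
  · rw [hessC_actC]
    simp [actC, e2]

/-- Let `f` be a ternary cubic form over `ℂ` with `Δ(f) ≠ 0`. Then the stabilizer of `f`
in `SL₃(ℂ)` has exactly 27 elements. -/
theorem stmt6 (P Q : MvPolynomial (Fin 10) ℚ) (hPQ : IsInvariantPair ℚ P Q)
    (c : Fin 10 → ℂ)
    (hΔ : (4 * (aeval c P : ℂ) ^ 3 - (aeval c Q : ℂ) ^ 2) / 27 ≠ 0) :
    {γ : Matrix.SpecialLinearGroup (Fin 3) ℂ |
      actGL (γ : Matrix (Fin 3) (Fin 3) ℂ) (cubic c) = cubic c}.ncard = 27 := by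
  have hg : Good c := by
    refine good_of_nd c ⟨P, Q, hPQ, ?_⟩
    intro h0
    apply hΔ
    rw [disc] at h0
    rw [h0, zero_div]
  rw [← hg]
  congr 1
  ext γ
  simp only [Set.mem_setOf_eq, actGL_cubic]
  exact ⟨cubic_inj, fun h => by rw [h]⟩
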